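/- Let H : [0,∞) → ℝ be twice differentiable, let λ > 0 and c > 0, and suppose H''(t) + λ H'(t) ≥ 2c for all t ≥ 0. Then H(t) ≥ H(0) + (1/λ)(H'(0) − 2c/λ)(1 − e^{−λt}) + (2c/λ) t for all t ≥ 0. -/

import Mathlib

open Real

theorem le_of_hasDerivAt_nonneg_aux (f f' : ℝ → ℝ)
    (hf : ∀ t, 0 ≤ t → HasDerivAt f (f' t) t) (hn : ∀ t, 0 ≤ t → 0 ≤ f' t)
    (t : ℝ) (ht : 0 ≤ t) : f 0 ≤ f t := by
  have hm : MonotoneOn f (Set.Ici 0) := by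
    apply monotoneOn_of_deriv_nonneg (convex_Ici 0)
    · intro x hx
      exact (hf x hx).continuousAt.continuousWithinAt
    · intro x hx
      rw [interior_Ici] at hx
      exact (hf x (le_of_lt hx)).differentiableAt.differentiableWithinAt
    · intro x hx
      rw [interior_Ici] at hx
      rw [(hf x (le_of_lt hx)).deriv]
      exact hn x (le_of_lt hx)
  exact hm (Set.mem_Ici.2 le_rfl) (Set.mem_Ici.2 ht) ht

/-- **Damped differential inequality.** If `H` is twice differentiable on `[0,∞)`,
`λ > 0`, `c > 0`, and `H'' + λ H' ≥ 2c` on `[0,∞)`, then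
`H(t) ≥ H(0) + (1/λ)(H'(0) - 2c/λ)(1 - e^{-λt}) + (2c/λ) t` for all `t ≥ 0`. -/
theorem damped_second_order_differential_inequality
    (H H' H'' : ℝ → ℝ) (lam c : ℝ) (hlam : 0 < lam) (hc : 0 < c)
    (hH' : ∀ t, 0 ≤ t → HasDerivAt H (H' t) t)
    (hH'' : ∀ t, 0 ≤ t → HasDerivAt H' (H'' t) t)
    (hineq : ∀ t, 0 ≤ t → 2 * c ≤ H'' t + lam * H' t) :
    ∀ t, 0 ≤ t →
      H 0 + (1 / lam) * (H' 0 - 2 * c / lam) * (1 - Real.exp (-lam * t))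
        + (2 * c / lam) * t ≤ H t := by
  have hl : lam ≠ 0 := hlam.ne'
  have h1 : ∀ t, 0 ≤ t →
      (H' 0 - 2 * c / lam) * Real.exp (-lam * t) ≤ H' t - 2 * c / lam := by
    intro t ht
    have h := le_of_hasDerivAt_nonneg_aux
      (fun s => (H' s - 2 * c / lam) * Real.exp (lam * s))
      (fun s => H'' s * Real.exp (lam * s)
        + (H' s - 2 * c / lam) * (Real.exp (lam * s) * (lam * 1)))
      (fun s hs => ((hH'' s hs).sub_const _).mul (((hasDerivAt_id s).const_mul lam).exp))
      (fun s hs => by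
        have e : H'' s * Real.exp (lam * s)
            + (H' s - 2 * c / lam) * (Real.exp (lam * s) * (lam * 1))
            = (H'' s + lam * H' s - 2 * c) * Real.exp (lam * s) := by
          field_simp
          ring
        show 0 ≤ H'' s * Real.exp (lam * s)
            + (H' s - 2 * c / lam) * (Real.exp (lam * s) * (lam * 1))
        rw [e]
        exact mul_nonneg (by linarith [hineq s hs]) (Real.exp_pos _).le) t ht
    simp only [mul_zero, Real.exp_zero, mul_one] at h
    have h2 := mul_le_mul_of_nonneg_right h (Real.exp_pos (-lam * t)).le
    rwa [mul_assoc (H' t - 2 * c / lam), ← Real.exp_add,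
      show lam * t + -lam * t = 0 by ring, Real.exp_zero, mul_one] at h2
  intro t ht
  have h := le_of_hasDerivAt_nonneg_aux
    (fun s => H s - ((1 / lam) * (H' 0 - 2 * c / lam) * (1 - Real.exp (-lam * s))
        + (2 * c / lam) * s))
    (fun s => H' s - ((1 / lam) * (H' 0 - 2 * c / lam) * (-(Real.exp (-lam * s) * (-lam * 1)))
        + (2 * c / lam) * 1))
    (fun s hs => (hH' s hs).sub
      ((((((hasDerivAt_id s).const_mul (-lam)).exp).const_sub 1).const_mul _).add
        ((hasDerivAt_id s).const_mul _)))
    (fun s hs => by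
      have e : (1 / lam) * (H' 0 - 2 * c / lam) * (-(Real.exp (-lam * s) * (-lam * 1)))
          = (H' 0 - 2 * c / lam) * Real.exp (-lam * s) := by
        field_simp
      show 0 ≤ H' s - ((1 / lam) * (H' 0 - 2 * c / lam)
        * (-(Real.exp (-lam * s) * (-lam * 1))) + (2 * c / lam) * 1)
      rw [e]
      linarith [h1 s hs]) t ht
  simp only [mul_zero, Real.exp_zero, sub_self, add_zero, sub_zero] at h
  linarith
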